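/- arXiv:1512.04494 — 8 statements merged into one kernel-verified Lean document; each statement's English description precedes it below -/
import Mathlib

section
/- Product rule for iterated finite differences (eq. (Leibniz2) of the paper): for all functions f₁, f₂ : ℝ → ℝ, every finite index set L, all parameters s : L → ℝ, and every t ∈ ℝ, one has Δ_{s_L}(f₁·f₂)(t) = Σ_{A ⊆ L} (Δ_{s_A} f₁)(t) · (Δ_{s_{L∖A}} f₂)(t + Σ_{a∈A} s_a), where the sum runs over all subsets A of L and f₁·f₂ denotes the pointwise product. -/
open Finset

/-- Iterated finite difference `Δ_{s_L} g` over the finite index set `L`: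
`(Δ_{s_L} g)(t) = ∑_{A ⊆ L} (-1)^{#L - #A} g(t + ∑_{ℓ∈A} s_ℓ)`. -/
noncomputable def iterDiff {ι : Type*} [DecidableEq ι] (L : Finset ι) (s : ι → ℝ)
    (g : ℝ → ℝ) (t : ℝ) : ℝ :=
  ∑ A ∈ L.powerset, (-1 : ℝ) ^ (L.card - A.card) * g (t + ∑ ℓ ∈ A, s ℓ)

theorem iterDiff_insert_aux {ι : Type*} [DecidableEq ι] (a : ι) (L : Finset ι) (ha : a ∉ L)
    (s : ι → ℝ) (g : ℝ → ℝ) (t : ℝ) :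
    iterDiff (insert a L) s g t = iterDiff L s g (t + s a) - iterDiff L s g t := by
  unfold iterDiff
  rw [Finset.sum_powerset_insert ha, add_comm, sub_eq_add_neg, ← Finset.sum_neg_distrib]
  congr 1
  · refine Finset.sum_congr rfl fun A hA => ?_
    have hAL := Finset.mem_powerset.1 hA
    have haA : a ∉ A := fun h => ha (hAL h)
    rw [Finset.card_insert_of_notMem ha, Finset.card_insert_of_notMem haA,
      Finset.sum_insert haA, Nat.add_sub_add_right, add_assoc]
  · refine Finset.sum_congr rfl fun A hA => ?_
    have hAL := Finset.card_le_card (Finset.mem_powerset.1 hA)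
    rw [Finset.card_insert_of_notMem ha, Nat.sub_add_comm hAL, pow_succ]
    ring

/-- Product rule for iterated finite differences (eq. (Leibniz2)). -/
theorem iterDiff_mul {ι : Type*} [DecidableEq ι] (L : Finset ι) (s : ι → ℝ)
    (f₁ f₂ : ℝ → ℝ) (t : ℝ) :
    iterDiff L s (fun u => f₁ u * f₂ u) t =
      ∑ A ∈ L.powerset,
        iterDiff A s f₁ t * iterDiff (L \ A) s f₂ (t + ∑ a ∈ A, s a) := by
  induction L using Finset.induction_on generalizing t with
  | empty => simp [iterDiff]
  | insert a L ha ih =>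
    rw [iterDiff_insert_aux a L ha, ih, ih, Finset.sum_powerset_insert ha,
      ← Finset.sum_sub_distrib, ← Finset.sum_add_distrib]
    refine Finset.sum_congr rfl fun A hA => ?_
    have hAL := Finset.mem_powerset.1 hA
    have haA : a ∉ A := fun h => ha (hAL h)
    have h1 : insert a L \ A = insert a (L \ A) := Finset.insert_sdiff_of_notMem L haA
    have h2 : insert a L \ insert a A = L \ A := by
      ext x
      simp only [Finset.mem_sdiff, Finset.mem_insert]
      grind
    have h3 : a ∉ L \ A := fun h => ha (Finset.mem_sdiff.1 h).1
    rw [h1, h2, iterDiff_insert_aux a (L \ A) h3, iterDiff_insert_aux a A haA,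
      Finset.sum_insert haA, show t + (s a + ∑ x ∈ A, s x) = t + s a + ∑ x ∈ A, s x by ring,
      show t + ∑ x ∈ A, s x + s a = t + s a + ∑ x ∈ A, s x by ring]
    ring
end

section
/- Iterated finite differences of monomials (eq. (Leibniz-pol) of the paper): for every n ∈ ℕ, every finite index set L, all s : L → ℝ, and every t ∈ ℝ, one has Δ_{s_L}(u ↦ uⁿ)(t) = Σ_κ (n! / ((n − |κ|)! · Π_{ℓ∈L} κ_ℓ!)) · t^{n−|κ|} · Π_{ℓ∈L} s_ℓ^{κ_ℓ}, where the sum runs over all κ : L → ℕ with κ_ℓ ≥ 1 for every ℓ ∈ L and |κ| := Σ_{ℓ∈L} κ_ℓ ≤ n (in particular the right-hand side is an empty sum, hence 0, when #L > n). -/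
open Finset

lemma multinomial_expand {L : Type*} [Fintype L] [DecidableEq L] (n : ℕ) (x : L → ℝ) (t : ℝ) :
    (t + ∑ ℓ, x ℓ) ^ n =
      ∑ κ ∈ (Fintype.piFinset fun _ : L => Finset.Icc 0 n).filter
          (fun κ => ∑ ℓ, κ ℓ ≤ n),
        (n.factorial : ℝ) /
            (((n - ∑ ℓ, κ ℓ).factorial : ℝ) * ∏ ℓ, ((κ ℓ).factorial : ℝ)) *
          t ^ (n - ∑ ℓ, κ ℓ) * ∏ ℓ, x ℓ ^ κ ℓ := by
  have h := Finset.sum_pow_eq_sum_piAntidiag (Finset.univ : Finset (Option L))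
    (fun o => o.elim t x) n
  rw [Fintype.sum_option] at h
  simp only [Option.elim] at h
  rw [h]
  refine Finset.sum_nbij' (fun k l => k (some l))
    (fun κ o => o.elim (n - ∑ ℓ, κ ℓ) κ) ?_ ?_ ?_ ?_ ?_
  · intro k hk
    simp only [Finset.mem_piAntidiag, Fintype.sum_option] at hk
    simp only [Finset.mem_filter, Fintype.mem_piFinset, Finset.mem_Icc]
    have h2 : ∑ l, k (some l) ≤ n := by omega
    exact ⟨fun a => ⟨Nat.zero_le _, (Finset.single_le_sum (f := fun l => k (some l))
      (fun _ _ => Nat.zero_le _) (Finset.mem_univ a)).trans h2⟩, h2⟩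
  · intro κ hκ
    simp only [Finset.mem_filter] at hκ
    simp only [Finset.mem_piAntidiag, Fintype.sum_option, Option.elim]
    exact ⟨by omega, by simp⟩
  · intro k hk
    simp only [Finset.mem_piAntidiag, Fintype.sum_option] at hk
    funext o
    cases o with
    | none => simp only [Option.elim]; omega
    | some l => rfl
  · intro κ hκ
    rfl
  · intro k hk
    simp only [Finset.mem_piAntidiag, Fintype.sum_option] at hk
    have h0 : n - ∑ l, k (some l) = k none := by omega
    have hs := Nat.multinomial_spec (Finset.univ : Finset (Option L)) k
    rw [Fintype.sum_option, Fintype.prod_option, hk.1] at hs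
    rw [h0, ← hs, Fintype.prod_option]
    have h1 : ((k none).factorial : ℝ) ≠ 0 := by positivity
    have h2 : (∏ l, ((k (some l)).factorial : ℝ)) ≠ 0 :=
      Finset.prod_ne_zero_iff.2 fun l _ => by positivity
    push_cast
    field_simp

/-- Iterated finite differences of monomials (eq. (Leibniz-pol)). -/
theorem iterDiff_pow {L : Type*} [Fintype L] [DecidableEq L] (n : ℕ) (s : L → ℝ) (t : ℝ) :
    iterDiff (Finset.univ : Finset L) s (fun u => u ^ n) t =
      ∑ κ ∈ (Fintype.piFinset fun _ : L => Finset.Icc 1 n).filter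
          (fun κ => ∑ ℓ, κ ℓ ≤ n),
        (n.factorial : ℝ) /
            (((n - ∑ ℓ, κ ℓ).factorial : ℝ) * ∏ ℓ, ((κ ℓ).factorial : ℝ)) *
          t ^ (n - ∑ ℓ, κ ℓ) * ∏ ℓ, s ℓ ^ κ ℓ := by
  have key : ∀ κ : L → ℕ, ∑ A ∈ (Finset.univ : Finset L).powerset,
      (-1 : ℝ) ^ ((Finset.univ : Finset L).card - A.card) *
        ∏ ℓ, (if ℓ ∈ A then s ℓ else 0) ^ κ ℓ = ∏ ℓ, (s ℓ ^ κ ℓ + (-1) * 0 ^ κ ℓ) := by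
    intro κ
    rw [Finset.prod_add]
    refine Finset.sum_congr rfl fun A hA => ?_
    rw [Finset.prod_mul_distrib, Finset.prod_const,
      Finset.card_sdiff_of_subset (Finset.subset_univ A),
      ← Finset.prod_sdiff (Finset.subset_univ A)]
    have e1 : ∏ x ∈ univ \ A, (if x ∈ A then s x else 0) ^ κ x = ∏ x ∈ univ \ A, (0:ℝ) ^ κ x :=
      Finset.prod_congr rfl fun x hx => by rw [if_neg (Finset.mem_sdiff.1 hx).2]
    have e2 : ∏ x ∈ A, (if x ∈ A then s x else 0) ^ κ x = ∏ x ∈ A, s x ^ κ x :=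
      Finset.prod_congr rfl fun x hx => by rw [if_pos hx]
    rw [e1, e2]
    ring
  have hexp : ∀ A : Finset L, (t + ∑ ℓ ∈ A, s ℓ) ^ n =
      (t + ∑ ℓ, if ℓ ∈ A then s ℓ else 0) ^ n := fun A => by simp
  unfold iterDiff
  simp only [hexp, multinomial_expand, Finset.mul_sum]
  rw [Finset.sum_comm]
  symm
  refine Finset.sum_subset_zero_on_sdiff ?_ ?_ ?_
  · intro κ hκ
    simp only [Finset.mem_filter, Fintype.mem_piFinset, Finset.mem_Icc] at hκ ⊢
    exact ⟨fun a => ⟨Nat.zero_le _, (hκ.1 a).2⟩, hκ.2⟩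
  · intro κ hκ
    simp only [Finset.mem_sdiff, Finset.mem_filter, Fintype.mem_piFinset, Finset.mem_Icc] at hκ
    rw [Finset.sum_congr rfl fun A _ => mul_left_comm _ _ _, ← Finset.mul_sum, key]
    have : ∃ a, κ a = 0 := by
      by_contra! hc
      exact hκ.2 ⟨fun a => ⟨Nat.one_le_iff_ne_zero.2 (hc a), (hκ.1.1 a).2⟩, hκ.1.2⟩
    obtain ⟨a, ha⟩ := this
    have hz : ∏ ℓ, (s ℓ ^ κ ℓ + (-1) * 0 ^ κ ℓ) = 0 :=
      Finset.prod_eq_zero (Finset.mem_univ a) (by simp [ha])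
    rw [hz, mul_zero]
  · intro κ hκ
    simp only [Finset.mem_filter, Fintype.mem_piFinset, Finset.mem_Icc] at hκ
    rw [Finset.sum_congr rfl fun A _ => mul_left_comm _ _ _, ← Finset.mul_sum, key]
    congr 1
    refine Finset.prod_congr rfl fun a _ => ?_
    have := (hκ.1 a).1
    rw [zero_pow (by omega)]
    ring
end

section
/- Integral representation of iterated finite differences of negative powers (eq. (Leibniz4) of the paper): for every α > 0, every finite index set L, all s : L → ℝ with s_ℓ > 0 for each ℓ ∈ L, and every t > 0, one has Δ_{s_L}(u ↦ u^{−α})(t) = Γ(α)^{−1} · ∫_0^∞ e^{−rt} · (Π_{ℓ∈L} (e^{−s_ℓ r} − 1)) · r^{α−1} dr, where Γ denotes the Gamma function; moreover the integrand on the right-hand side is integrable on (0,∞). -/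
open Finset MeasureTheory

/-- Integral representation of iterated finite differences of negative powers
(eq. (Leibniz4)), together with the integrability of the integrand. -/
theorem iterDiff_rpow_neg {ι : Type*} [DecidableEq ι] (L : Finset ι) (s : ι → ℝ)
    (hs : ∀ ℓ ∈ L, 0 < s ℓ) (α t : ℝ) (hα : 0 < α) (ht : 0 < t) :
    IntegrableOn
        (fun r : ℝ =>
          Real.exp (-(r * t)) * (∏ ℓ ∈ L, (Real.exp (-(s ℓ * r)) - 1)) * r ^ (α - 1))
        (Set.Ioi 0) ∧
      iterDiff L s (fun u => u ^ (-α)) t =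
        (Real.Gamma α)⁻¹ *
          ∫ r in Set.Ioi (0 : ℝ),
            Real.exp (-(r * t)) * (∏ ℓ ∈ L, (Real.exp (-(s ℓ * r)) - 1)) * r ^ (α - 1) := by
  have hpos : ∀ A ∈ L.powerset, 0 < t + ∑ ℓ ∈ A, s ℓ := by
    intro A hA
    have : 0 ≤ ∑ ℓ ∈ A, s ℓ :=
      Finset.sum_nonneg fun ℓ h => (hs ℓ (Finset.mem_powerset.mp hA h)).le
    linarith
  have hint : ∀ A ∈ L.powerset, IntegrableOn (fun r : ℝ => (-1 : ℝ) ^ (L.card - A.card) *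
      (r ^ (α - 1) * Real.exp (-((t + ∑ ℓ ∈ A, s ℓ) * r)))) (Set.Ioi 0) := by
    intro A hA
    have h := integrableOn_rpow_mul_exp_neg_mul_rpow (p := 1) (s := α - 1)
      (by linarith) one_pos (hpos A hA)
    simp only [Real.rpow_one, neg_mul] at h
    exact h.const_mul _
  have heq : (fun r : ℝ =>
      Real.exp (-(r * t)) * (∏ ℓ ∈ L, (Real.exp (-(s ℓ * r)) - 1)) * r ^ (α - 1)) =
      fun r : ℝ => ∑ A ∈ L.powerset, (-1 : ℝ) ^ (L.card - A.card) *
        (r ^ (α - 1) * Real.exp (-((t + ∑ ℓ ∈ A, s ℓ) * r))) := by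
    funext r
    simp only [sub_eq_add_neg]
    rw [Finset.prod_add, Finset.mul_sum, Finset.sum_mul]
    refine Finset.sum_congr rfl fun A hA => ?_
    rw [Finset.prod_const, Finset.card_sdiff_of_subset (Finset.mem_powerset.mp hA),
      ← Real.exp_sum]
    have : Real.exp (-((t + ∑ ℓ ∈ A, s ℓ) * r)) =
        Real.exp (-(r * t)) * Real.exp (∑ ℓ ∈ A, -(s ℓ * r)) := by
      rw [← Real.exp_add, Finset.sum_neg_distrib, ← Finset.sum_mul]
      congr 1
      ring
    rw [this]
    ring
  rw [heq]
  refine ⟨integrable_finsetSum _ hint, ?_⟩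
  rw [integral_finsetSum _ hint, iterDiff, Finset.mul_sum]
  refine Finset.sum_congr rfl fun A hA => ?_
  rw [integral_const_mul, Real.integral_rpow_mul_exp_neg_mul_Ioi hα (hpos A hA), one_div,
    Real.inv_rpow (hpos A hA).le, ← Real.rpow_neg (hpos A hA).le]
  have := (Real.Gamma_pos_of_pos hα).ne'
  field_simp
end

section
/- Lemma A.3, bound (Leibniz77): let α > 0, let L be a finite index set and δ : L → [0,1]. Then there exists a constant c > 0, depending only on α, #L and δ, such that for all ε ∈ [0,1], all s : L → ℝ with s_ℓ > 0 for each ℓ ∈ L, and all t > 0: |Δ_{s_L}(u ↦ F_ε(u)^{α})(t)| ≤ c · ( Σ_{ℓ ∈ {0} ∪ L} F_ε(t + s_ℓ)^{α} · (t + s_ℓ)^{−|δ|} ) · Π_{ℓ∈L} s_ℓ^{δ_ℓ}, where s₀ := 0 (so the ℓ = 0 summand is F_ε(t)^α · t^{−|δ|}) and |δ| := Σ_{ℓ∈L} δ_ℓ. -/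
open Finset

lemma iterDiff_insert' {ι : Type*} [DecidableEq ι] (S : Finset ι) (a : ι) (ha : a ∉ S) (s : ι → ℝ)
    (g : ℝ → ℝ) (t : ℝ) :
    iterDiff (insert a S) s g t = iterDiff S s g (t + s a) - iterDiff S s g t := by
  unfold iterDiff
  rw [Finset.sum_powerset_insert ha, add_comm, sub_eq_add_neg, ← Finset.sum_neg_distrib]
  congr 1
  · refine Finset.sum_congr rfl fun A hA => ?_
    have hA' := Finset.mem_powerset.1 hA
    have haA : a ∉ A := fun h => ha (hA' h)
    rw [Finset.card_insert_of_notMem ha, Finset.card_insert_of_notMem haA,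
      Finset.sum_insert haA, Nat.add_sub_add_right, add_assoc]
  · refine Finset.sum_congr rfl fun A hA => ?_
    have hA' := Finset.card_le_card (Finset.mem_powerset.1 hA)
    rw [Finset.card_insert_of_notMem ha, Nat.succ_sub hA', pow_succ]
    ring

lemma iterDiff_hasDerivAt {ι : Type*} [DecidableEq ι] (S : Finset ι) (s : ι → ℝ)
    (hs : ∀ i, 0 < s i) (f f' : ℝ → ℝ) (hf : ∀ x, 0 < x → HasDerivAt f (f' x) x)
    (x : ℝ) (hx : 0 < x) : HasDerivAt (iterDiff S s f) (iterDiff S s f' x) x := by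
  unfold iterDiff
  refine HasDerivAt.fun_sum fun A _ => ?_
  refine HasDerivAt.const_mul _ ?_
  refine HasDerivAt.comp_add_const x _ (hf _ ?_)
  have := Finset.sum_nonneg (s := A) (f := s) (fun i _ => (hs i).le)
  linarith

lemma iterDiff_mvt {ι : Type*} [DecidableEq ι] (s : ι → ℝ)
    (hs : ∀ i, 0 < s i) (S : Finset ι) : ∀ (f : ℕ → ℝ → ℝ)
    (_ : ∀ k x, 0 < x → HasDerivAt (f k) (f (k+1) x) x) (t M : ℝ) (_ : 0 < t)
    (_ : ∀ u, t ≤ u → u ≤ t + ∑ i ∈ S, s i → |f S.card u| ≤ M),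
    |iterDiff S s (f 0) t| ≤ M * ∏ i ∈ S, s i := by
  induction S using Finset.induction_on with
  | empty =>
    intro f hf t M ht hM
    simpa [iterDiff] using hM t le_rfl (by simp)
  | insert a S ha ih =>
    intro f hf t M ht hM
    rw [iterDiff_insert' S a ha, Finset.prod_insert ha]
    rw [Finset.sum_insert ha, Finset.card_insert_of_notMem ha] at hM
    have hsa := hs a
    have key := Convex.norm_image_sub_le_of_norm_hasDerivWithin_le
      (f := iterDiff S s (f 0)) (f' := iterDiff S s (f 1)) (s := Set.Icc t (t + s a))
      (C := M * ∏ i ∈ S, s i) (x := t) (y := t + s a)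
      (fun x hx => (iterDiff_hasDerivAt S s hs _ _ (hf 0) x
        (lt_of_lt_of_le ht hx.1)).hasDerivWithinAt)
      (fun x hx => by
        refine ih (fun k => f (k+1)) (fun k => hf (k+1)) x M (lt_of_lt_of_le ht hx.1) ?_
        intro u hu1 hu2
        exact hM u (hx.1.trans hu1) (by linarith [hx.2]))
      (convex_Icc _ _) (Set.left_mem_Icc.2 (by linarith)) (Set.right_mem_Icc.2 (by linarith))
    rw [Real.norm_eq_abs, Real.norm_eq_abs, add_sub_cancel_left, abs_of_pos hsa] at key
    linarith

/-- The polynomials describing the derivatives of `F_ε ^ α`. -/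
noncomputable def leibPoly (α : ℝ) : ℕ → Polynomial ℝ
  | 0 => 1
  | k + 1 => (Polynomial.C α * Polynomial.X - Polynomial.C (k : ℝ)) * leibPoly α k
      + (Polynomial.X ^ 2 - Polynomial.X) * Polynomial.derivative (leibPoly α k)

lemma leib_deriv (α ε : ℝ) (hε : 0 ≤ ε) (k : ℕ) (x : ℝ) (hx : 0 < x) :
    HasDerivAt (fun u => (u / (1 + ε * u)) ^ α * (u ^ k)⁻¹ *
        (leibPoly α k).eval ((1 + ε * u)⁻¹))
      ((x / (1 + ε * x)) ^ α * (x ^ (k+1))⁻¹ *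
        (leibPoly α (k+1)).eval ((1 + ε * x)⁻¹)) x := by
  have h1 : 0 < 1 + ε * x := by positivity
  have hF : 0 < x / (1 + ε * x) := by positivity
  have hd : HasDerivAt (fun u : ℝ => 1 + ε * u) ε x := by
    simpa using ((hasDerivAt_id x).const_mul ε).const_add 1
  have hw := hd.fun_inv h1.ne'
  have hq := ((hasDerivAt_id' x).fun_div hd h1.ne').rpow_const (p := α) (Or.inl hF.ne')
  have hk := (hasDerivAt_pow k x).fun_inv (pow_pos hx k).ne'
  have hp := ((leibPoly α k).hasDerivAt ((1 + ε * x)⁻¹)).comp x hw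
  have := (hq.mul hk).mul hp
  refine this.congr_deriv ?_
  rw [Real.rpow_sub_one hF.ne']
  simp only [leibPoly, Polynomial.eval_add, Polynomial.eval_mul, Polynomial.eval_sub,
    Polynomial.eval_C, Polynomial.eval_X, Polynomial.eval_pow, Function.comp_apply, Pi.mul_apply]
  generalize Polynomial.eval (1 + ε * x)⁻¹ (leibPoly α k) = p
  generalize Polynomial.eval (1 + ε * x)⁻¹ (Polynomial.derivative (leibPoly α k)) = p'
  generalize (x / (1 + ε * x)) ^ α = q
  rcases k with _ | k
  · simp
    field_simp
    ring
  · simp only [Nat.add_sub_cancel]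
    push_cast
    field_simp
    ring

lemma leibPoly_bound (α : ℝ) (k : ℕ) : ∃ C : ℝ, 0 ≤ C ∧ ∀ w ∈ Set.Icc (0:ℝ) 1,
    |(leibPoly α k).eval w| ≤ C := by
  obtain ⟨C, hC⟩ := (isCompact_Icc (a := (0:ℝ)) (b := 1)).exists_bound_of_continuousOn
    (leibPoly α k).continuous.continuousOn
  exact ⟨C, (abs_nonneg _).trans (hC 0 (by simp)), hC⟩

lemma leib_small {ι : Type*} [DecidableEq ι] (α : ℝ) (hα : 0 < α) (n : ℕ) :
    ∃ D : ℝ, 0 ≤ D ∧ ∀ ε : ℝ, 0 ≤ ε → ∀ s : ι → ℝ, (∀ i, 0 < s i) →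
      ∀ δ : ι → ℝ, (∀ i, δ i ∈ Set.Icc (0:ℝ) 1) → ∀ S : Finset ι, S.card = n →
      ∀ t : ℝ, 0 < t → (∀ i ∈ S, s i ≤ t) →
      |iterDiff S s (fun u => (u / (1 + ε * u)) ^ α) t| ≤
        D * ((t / (1 + ε * t)) ^ α * t ^ (-∑ i ∈ S, δ i)) * ∏ i ∈ S, s i ^ δ i := by
  obtain ⟨C, hC0, hC⟩ := leibPoly_bound α n
  refine ⟨C * (1 + n : ℝ) ^ α, by positivity, ?_⟩
  intro ε hε s hs δ hδ S hS t ht hst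
  have hsum : ∑ i ∈ S, s i ≤ n * t := by
    have := Finset.sum_le_card_nsmul S s t hst
    rwa [hS, nsmul_eq_mul] at this
  have key := iterDiff_mvt s hs S (fun k u => (u / (1 + ε * u)) ^ α * (u ^ k)⁻¹ *
        (leibPoly α k).eval ((1 + ε * u)⁻¹)) (fun k x hx => leib_deriv α ε hε k x hx) t
        (((1 + n : ℝ) ^ α * (t / (1 + ε * t)) ^ α) * (t ^ n)⁻¹ * C) ht (by
    intro u hu1 hu2
    have hu : 0 < u := lt_of_lt_of_le ht hu1
    have h1 : 0 < 1 + ε * u := by positivity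
    have h2 : 0 < 1 + ε * t := by positivity
    have hq : (u / (1 + ε * u)) ^ α ≤ (1 + n : ℝ) ^ α * (t / (1 + ε * t)) ^ α := by
      rw [← Real.mul_rpow (by positivity) (by positivity)]
      refine Real.rpow_le_rpow (by positivity) ?_ hα.le
      rw [← mul_div_assoc]
      have : ε * t ≤ ε * u := by gcongr
      gcongr ?_ / ?_
      · nlinarith
      · linarith
    rw [hS, abs_mul, abs_of_nonneg (by positivity : 0 ≤ (u / (1 + ε * u)) ^ α * (u ^ n)⁻¹)]
    have hw := hC ((1 + ε * u)⁻¹) ⟨by positivity, inv_le_one_of_one_le₀ (by nlinarith)⟩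
    have hi : (u ^ n)⁻¹ ≤ (t ^ n)⁻¹ := by gcongr
    gcongr)
  simp only [pow_zero, inv_one, mul_one, leibPoly, Polynomial.eval_one] at key
  have hprod : (t ^ n)⁻¹ * ∏ i ∈ S, s i ≤ t ^ (-∑ i ∈ S, δ i) * ∏ i ∈ S, s i ^ δ i := by
    have e1 : (t ^ n)⁻¹ * ∏ i ∈ S, s i = ∏ i ∈ S, s i / t := by
      rw [Finset.prod_div_distrib, Finset.prod_const, hS]
      ring
    have e2 : t ^ (-∑ i ∈ S, δ i) * ∏ i ∈ S, s i ^ δ i = ∏ i ∈ S, (s i / t) ^ δ i := by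
      rw [Real.rpow_neg ht.le, Real.rpow_sum_of_pos ht,
        Finset.prod_congr rfl fun i _ => Real.div_rpow (hs i).le ht.le (δ i),
        Finset.prod_div_distrib]
      ring
    rw [e1, e2]
    refine Finset.prod_le_prod (fun i _ => (div_pos (hs i) ht).le) fun i hi => ?_
    exact Real.self_le_rpow_of_le_one (div_pos (hs i) ht).le
      ((div_le_one ht).2 (hst i hi)) (hδ i).2
  refine key.trans ?_
  calc _ = (C * (1 + n : ℝ) ^ α * (t / (1 + ε * t)) ^ α) * ((t ^ n)⁻¹ * ∏ i ∈ S, s i) := by ring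
    _ ≤ (C * (1 + n : ℝ) ^ α * (t / (1 + ε * t)) ^ α) *
        (t ^ (-∑ i ∈ S, δ i) * ∏ i ∈ S, s i ^ δ i) := by gcongr
    _ = _ := by ring

lemma leib_shift (x y σ d : ℝ) (hx : 0 < x) (hy : 0 < y) (hxy : x ≤ 2 * y) (hd0 : 0 ≤ d)
    (hd1 : d ≤ 1) : x ^ (-σ) ≤ 2 * (x ^ (-(d + σ)) * y ^ d) := by
  have e : x ^ (-σ) = x ^ (-(d + σ)) * x ^ d := by
    rw [← Real.rpow_add hx]
    congr 1
    ring
  have h1 : x ^ d ≤ 2 * y ^ d := by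
    calc x ^ d ≤ (2 * y) ^ d := Real.rpow_le_rpow hx.le hxy hd0
      _ = 2 ^ d * y ^ d := Real.mul_rpow (by norm_num) hy.le
      _ ≤ 2 * y ^ d := by
        gcongr
        exact Real.rpow_le_self_of_one_le (by norm_num) hd1
  rw [e]
  calc _ ≤ x ^ (-(d + σ)) * (2 * y ^ d) := by gcongr
    _ = _ := by ring

lemma leib_main {ι : Type*} [DecidableEq ι] (α : ℝ) (hα : 0 < α) (n : ℕ) :
    ∃ c : ℝ, 0 ≤ c ∧ ∀ ε : ℝ, 0 ≤ ε → ∀ s : ι → ℝ, (∀ i, 0 < s i) →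
      ∀ δ : ι → ℝ, (∀ i, δ i ∈ Set.Icc (0:ℝ) 1) → ∀ S : Finset ι, S.card = n →
      ∀ t : ℝ, 0 < t →
      |iterDiff S s (fun u => (u / (1 + ε * u)) ^ α) t| ≤
        c * ((t / (1 + ε * t)) ^ α * t ^ (-∑ i ∈ S, δ i) +
          ∑ j ∈ S, ((t + s j) / (1 + ε * (t + s j))) ^ α * (t + s j) ^ (-∑ i ∈ S, δ i)) *
            ∏ i ∈ S, s i ^ δ i := by
  induction n with
  | zero =>
    refine ⟨1, by norm_num, ?_⟩
    intro ε hε s hs δ hδ S hS t ht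
    rw [Finset.card_eq_zero] at hS
    subst hS
    simp [iterDiff]
    rw [abs_of_nonneg (by positivity)]
  | succ n ih =>
    obtain ⟨c, hc0, hc⟩ := ih
    obtain ⟨D, hD0, hD⟩ := leib_small (ι := ι) α hα n
    obtain ⟨E, hE0, hE⟩ := leib_small (ι := ι) α hα (n + 1)
    refine ⟨E + 2 * D + 2 * c, by positivity, ?_⟩
    intro ε hε s hs δ hδ S hS t ht
    have hgpos : ∀ u, 0 < u → 0 ≤ (u / (1 + ε * u)) ^ α := fun u hu => by positivity
    have hts : ∀ j, 0 < t + s j := fun j => by linarith [hs j]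
    obtain ⟨a, haS, hmax⟩ := Finset.exists_max_image S s (Finset.card_pos.1 (by omega))
    have hP : 0 ≤ ∏ i ∈ S, s i ^ δ i :=
      Finset.prod_nonneg fun i _ => Real.rpow_nonneg (hs i).le _
    have hQ : ∀ T : Finset ι, ∀ σ : ℝ, 0 ≤
        ∑ j ∈ T, ((t + s j) / (1 + ε * (t + s j))) ^ α * (t + s j) ^ (-σ) := fun T σ =>
      Finset.sum_nonneg fun j _ =>
        mul_nonneg (hgpos _ (hts j)) (Real.rpow_nonneg (hts j).le _)
    have hg0 : 0 ≤ (t / (1 + ε * t)) ^ α * t ^ (-∑ i ∈ S, δ i) := by positivity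
    by_cases hat : s a ≤ t
    · refine (hE ε hε s hs δ hδ S hS t ht fun i hi => (hmax i hi).trans hat).trans ?_
      gcongr ?_ * ?_ * _
      · linarith
      · linarith [hQ S (∑ i ∈ S, δ i)]
    · push Not at hat
      obtain ⟨T, haT, rfl⟩ : ∃ T, a ∉ T ∧ S = insert a T :=
        ⟨S.erase a, Finset.notMem_erase _ _, (Finset.insert_erase haS).symm⟩
      rw [Finset.card_insert_of_notMem haT, Nat.add_right_cancel_iff] at hS
      have hmaxT : ∀ i ∈ T, s i ≤ s a := fun i hi => hmax i (Finset.mem_insert_of_mem hi)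
      have b1 := hD ε hε s hs δ hδ T hS (t + s a) (hts a) fun i hi => by linarith [hmaxT i hi]
      have b2 := hc ε hε s hs δ hδ T hS t ht
      rw [iterDiff_insert' T a haT]
      rw [Finset.sum_insert haT] at hg0 ⊢
      rw [Finset.prod_insert haT] at hP ⊢
      rw [Finset.sum_insert haT]
      set σ := ∑ i ∈ T, δ i
      set P := ∏ i ∈ T, s i ^ δ i
      have hP' : 0 ≤ P := Finset.prod_nonneg fun i _ => Real.rpow_nonneg (hs i).le _
      have hd := hδ a
      have sh : ∀ x, 0 < x → x ≤ 2 * s a → (x / (1 + ε * x)) ^ α * x ^ (-σ) ≤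
          2 * s a ^ δ a * ((x / (1 + ε * x)) ^ α * x ^ (-(δ a + σ))) := fun x hx hx2 => by
        have := mul_le_mul_of_nonneg_left
          (leib_shift x (s a) σ (δ a) hx (hs a) hx2 hd.1 hd.2) (hgpos x hx)
        linarith
      have s1 := sh (t + s a) (hts a) (by linarith)
      have s2 := sh t ht (by linarith [hs a])
      have s3 : ∑ j ∈ T, ((t + s j) / (1 + ε * (t + s j))) ^ α * (t + s j) ^ (-σ) ≤
          2 * s a ^ δ a *
          ∑ j ∈ T, ((t + s j) / (1 + ε * (t + s j))) ^ α * (t + s j) ^ (-(δ a + σ)) := by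
        rw [Finset.mul_sum]
        exact Finset.sum_le_sum fun j hj => sh _ (hts j) (by linarith [hmaxT j hj])
      have hQ' := hQ T (δ a + σ)
      have hga : 0 ≤ ((t + s a) / (1 + ε * (t + s a))) ^ α * (t + s a) ^ (-(δ a + σ)) :=
        mul_nonneg (hgpos _ (hts a)) (Real.rpow_nonneg (hts a).le _)
      set X0 := (t / (1 + ε * t)) ^ α * t ^ (-(δ a + σ))
      set Xa := ((t + s a) / (1 + ε * (t + s a))) ^ α * (t + s a) ^ (-(δ a + σ))
      set Y := ∑ j ∈ T, ((t + s j) / (1 + ε * (t + s j))) ^ α * (t + s j) ^ (-(δ a + σ))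
      set W := s a ^ δ a
      have b1' := b1.trans (mul_le_mul_of_nonneg_right (mul_le_mul_of_nonneg_left s1 hD0) hP')
      have b2' := b2.trans (mul_le_mul_of_nonneg_right
        (mul_le_mul_of_nonneg_left (add_le_add s2 s3) hc0) hP')
      refine (abs_sub _ _).trans ((add_le_add b1' b2').trans ?_)
      have e1 : 0 ≤ E * (X0 + (Xa + Y)) * (W * P) := by positivity
      have e2 : 0 ≤ 2 * D * (X0 + Y) * (W * P) := by positivity
      have e3 : 0 ≤ 2 * c * Xa * (W * P) := by positivity
      linarith

/-- Lemma A.3, bound (Leibniz77): weighted bound on iterated finite differences of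
`u ↦ F_ε(u)^{α}` where `F_ε(u) = u/(1+εu)`; the `ℓ = 0` summand (with `s₀ = 0`) is
written out as the first term inside the parentheses. -/
theorem leibniz77 {L : Type*} [Fintype L] [DecidableEq L] (α : ℝ) (hα : 0 < α)
    (δ : L → ℝ) (hδ : ∀ ℓ, δ ℓ ∈ Set.Icc (0 : ℝ) 1) :
    ∃ c : ℝ, 0 < c ∧
      ∀ ε : ℝ, ε ∈ Set.Icc (0 : ℝ) 1 →
        ∀ s : L → ℝ, (∀ ℓ, 0 < s ℓ) → ∀ t : ℝ, 0 < t →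
          |iterDiff (Finset.univ : Finset L) s (fun u => (u / (1 + ε * u)) ^ α) t| ≤
            c * ((t / (1 + ε * t)) ^ α * t ^ (-(∑ ℓ, δ ℓ)) +
                  ∑ ℓ, ((t + s ℓ) / (1 + ε * (t + s ℓ))) ^ α *
                    (t + s ℓ) ^ (-(∑ ℓ', δ ℓ'))) *
              ∏ ℓ, s ℓ ^ δ ℓ := by
  obtain ⟨c, hc0, hc⟩ := leib_main (ι := L) α hα (Finset.univ : Finset L).card
  refine ⟨c + 1, by linarith, ?_⟩
  intro ε hε s hs t ht
  have hts : ∀ j, 0 < t + s j := fun j => by linarith [hs j]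
  have hε0 := hε.1
  refine (hc ε hε0 s hs δ hδ Finset.univ rfl t ht).trans ?_
  have hP : 0 ≤ ∏ i, s i ^ δ i :=
    Finset.prod_nonneg fun i _ => Real.rpow_nonneg (hs i).le _
  have hQ : 0 ≤ ∑ j, ((t + s j) / (1 + ε * (t + s j))) ^ α * (t + s j) ^ (-(∑ i, δ i)) :=
    Finset.sum_nonneg fun j _ => by
      have := hts j
      positivity
  have hg0 : 0 ≤ (t / (1 + ε * t)) ^ α * t ^ (-∑ i, δ i) := by positivity
  gcongr
  linarith
end

section
/- Iterated derivative formula for the regularized exponential weight (displayed identity in the proof of Lemma A.3, obtained from Faà di Bruno's formula): for every integer k ≥ 1, every a ∈ ℝ, every ε ∈ [0,1], and every t ≥ 0, the k-th derivative of the function u ↦ exp(a·u/(1+εu)) at the point t equals exp(a F_ε(t)) · Σ_{ℓ=1}^{k} c_{k,ℓ} · a^ℓ · (−ε)^{k−ℓ} · (1+εt)^{−(k+ℓ)}, where c_{k,ℓ} := (k!/ℓ!) · #{α ∈ (ℕ_{≥1})^ℓ : α₁ + ⋯ + α_ℓ = k}. -/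
open Finset

lemma card_comp_aux (n m : ℕ) (h : m ≤ n) :
    ((Fintype.piFinset fun _ : Fin (m + 1) => Finset.Icc 1 (n + 1)).filter
      (fun α => ∑ i, α i = n + 1)).card = n.choose m := by
  have h1 : n.choose m =
      (Finset.finsuppAntidiag (Finset.univ : Finset (Fin (m + 1))) (n - m)).card := by
    rw [Finset.card_finsuppAntidiag_nat_eq_choose]
    simp only [Finset.card_univ, Fintype.card_fin]
    have : m + 1 + (n - m) - 1 = n := by omega
    rw [this, Nat.choose_symm h]
  rw [h1]
  refine Finset.card_bij' (fun α _ => Finsupp.equivFunOnFinite.symm (fun i => α i - 1))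
    (fun β _ => fun i => β i + 1) ?_ ?_ ?_ ?_
  · intro α hα
    simp only [Finset.mem_filter, Fintype.mem_piFinset, Finset.mem_Icc] at hα
    simp only [Finset.mem_finsuppAntidiag, Finset.subset_univ, and_true,
      Finsupp.equivFunOnFinite_symm_apply_apply]
    have h2 : ∑ i, (α i - 1 + 1) = ∑ i, α i :=
      Finset.sum_congr rfl fun i _ => Nat.sub_add_cancel (hα.1 i).1
    rw [Finset.sum_add_distrib] at h2
    simp at h2
    omega
  · intro β hβ
    simp only [Finset.mem_finsuppAntidiag, Finset.subset_univ, and_true] at hβ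
    simp only [Finset.mem_filter, Fintype.mem_piFinset, Finset.mem_Icc]
    refine ⟨fun i => ⟨by omega, ?_⟩, ?_⟩
    · have := Finset.single_le_sum (f := fun i => β i) (fun i _ => Nat.zero_le _)
        (Finset.mem_univ i)
      have h3 : ∑ x, β x = n - m := hβ
      omega
    · rw [Finset.sum_add_distrib, hβ]
      simp
      omega
  · intro α hα
    simp only [Finset.mem_filter, Fintype.mem_piFinset, Finset.mem_Icc] at hα
    funext i
    simp [Nat.sub_add_cancel (hα.1 i).1]
  · intro β hβ
    ext i
    simp

/-- Shifted Lah numbers. -/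
noncomputable def lahC (n m : ℕ) : ℝ :=
  ((n + 1).factorial : ℝ) / ((m + 1).factorial : ℝ) * (n.choose m : ℝ)

lemma lahC_zero (n : ℕ) : lahC (n + 1) 0 = (n + 2) * lahC n 0 := by
  simp only [lahC, Nat.factorial_succ, Nat.choose_zero_right]
  push_cast
  ring

lemma lahC_succ (n m : ℕ) (h : m ≤ n) :
    lahC (n + 1) (m + 1) = (n + m + 3) * lahC n (m + 1) + lahC n m := by
  have h1 := Nat.choose_succ_right_eq n m
  have h2 : (n.choose (m + 1) : ℝ) * (m + 1) = n.choose m * (n - m) := by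
    rw [← Nat.cast_sub h]
    exact_mod_cast h1
  have h3 : ((m.factorial : ℕ) : ℝ) ≠ 0 := by positivity
  have h4 : (m : ℝ) + 1 ≠ 0 := by positivity
  have h5 : (m : ℝ) + 1 + 1 ≠ 0 := by positivity
  simp only [lahC, Nat.factorial_succ, Nat.choose_succ_succ]
  push_cast
  field_simp
  linear_combination (-1 : ℝ) * h2

lemma lahC_self (n : ℕ) : lahC n (n + 1) = 0 := by
  simp [lahC]

lemma iter_aux (n : ℕ) (a ε : ℝ) : ∀ t : ℝ, 0 < 1 + ε * t →
    iteratedDeriv (n + 1) (fun u : ℝ => Real.exp (a * (u / (1 + ε * u)))) t =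
      Real.exp (a * (t / (1 + ε * t))) * ∑ m ∈ Finset.range (n + 1),
        lahC n m * (a ^ (m + 1) * (-ε) ^ (n - m) / (1 + ε * t) ^ (n + m + 2)) := by
  have hlin : ∀ t : ℝ, HasDerivAt (fun u : ℝ => 1 + ε * u) ε t := fun t => by
    simpa using ((hasDerivAt_id t).const_mul ε).const_add 1
  have hE : ∀ t : ℝ, 0 < 1 + ε * t →
      HasDerivAt (fun u : ℝ => Real.exp (a * (u / (1 + ε * u))))
        (Real.exp (a * (t / (1 + ε * t))) * (a / (1 + ε * t) ^ 2)) t := by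
    intro t ht
    have h := ((((hasDerivAt_id t).div (hlin t) ht.ne').const_mul a)).exp
    convert! h using 1
    simp only [id, Pi.div_apply]
    congr 1
    field_simp
    ring
  induction n with
  | zero =>
    intro t ht
    rw [zero_add, iteratedDeriv_one, (hE t ht).deriv]
    simp [lahC]
  | succ n ih =>
    intro t ht
    have hev : iteratedDeriv (n + 1) (fun u : ℝ => Real.exp (a * (u / (1 + ε * u))))
        =ᶠ[nhds t] fun t => Real.exp (a * (t / (1 + ε * t))) * ∑ m ∈ Finset.range (n + 1),
        lahC n m * (a ^ (m + 1) * (-ε) ^ (n - m) / (1 + ε * t) ^ (n + m + 2)) := by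
      have : ∀ᶠ u in nhds t, 0 < 1 + ε * u :=
        (hlin t).continuousAt.eventually (lt_mem_nhds ht)
      filter_upwards [this] with u hu using ih u hu
    rw [iteratedDeriv_succ, hev.deriv_eq]
    have hT : ∀ m ∈ Finset.range (n + 1), HasDerivAt (fun t : ℝ =>
        lahC n m * (a ^ (m + 1) * (-ε) ^ (n - m) / (1 + ε * t) ^ (n + m + 2)))
        ((n + m + 2) * lahC n m *
          (a ^ (m + 1) * (-ε) ^ (n + 1 - m) / (1 + ε * t) ^ (n + m + 3))) t := by
      intro m hm
      have hm' : m ≤ n := by simpa [Nat.lt_succ_iff] using hm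
      have h := ((hasDerivAt_const t (a ^ (m + 1) * (-ε) ^ (n - m))).div
        ((hlin t).pow (n + m + 2)) (pow_ne_zero _ ht.ne')).const_mul (lahC n m)
      convert! h using 1
      rw [Nat.sub_add_comm hm', pow_succ (-ε)]
      have e : n + m + 2 - 1 = n + m + 1 := rfl
      simp only [e, Pi.pow_apply]
      push_cast
      field_simp
      ring
    rw [((hE t ht).fun_mul (HasDerivAt.fun_sum hT)).deriv]
    have hS : ∑ m ∈ Finset.range (n + 1), ((n + m + 2) * lahC n m *
          (a ^ (m + 1) * (-ε) ^ (n + 1 - m) / (1 + ε * t) ^ (n + m + 3))) =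
        ∑ m ∈ Finset.range (n + 1), ((n + m + 3) * lahC n (m + 1) *
          (a ^ (m + 2) * (-ε) ^ (n - m) / (1 + ε * t) ^ (n + m + 4))) +
        (n + 2) * lahC n 0 * (a * (-ε) ^ (n + 1) / (1 + ε * t) ^ (n + 3)) := by
      have h1 := Finset.sum_range_succ (fun m : ℕ => ((n + m + 2) * lahC n m *
          (a ^ (m + 1) * (-ε) ^ (n + 1 - m) / (1 + ε * t) ^ (n + m + 3)))) (n + 1)
      rw [lahC_self, mul_zero, zero_mul, add_zero] at h1
      rw [← h1, Finset.sum_range_succ']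
      congr 1
      · refine Finset.sum_congr rfl fun m _ => ?_
        rw [Nat.add_sub_add_right]
        push_cast
        ring
      · simp
    rw [hS, Finset.sum_range_succ' _ (n + 1), lahC_zero, mul_assoc, ← mul_add]
    congr 1
    rw [← add_assoc, Finset.mul_sum, ← Finset.sum_add_distrib]
    congr 1
    · refine Finset.sum_congr rfl fun m hm => ?_
      have hm' : m ≤ n := by simpa [Nat.lt_succ_iff] using hm
      rw [lahC_succ n m hm', Nat.add_sub_add_right]
      field_simp
      ring
    · simp

/-- Iterated derivative formula for the regularized exponential weight
`u ↦ exp(a·u/(1+εu))` (displayed identity in the proof of Lemma A.3, from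
Faà di Bruno's formula), with
`c_{k,ℓ} = (k!/ℓ!) · #{α ∈ ℕ_{≥1}^ℓ : α₁ + ⋯ + α_ℓ = k}`. -/
theorem iteratedDeriv_exp_reg (k : ℕ) (hk : 1 ≤ k) (a ε : ℝ)
    (hε : ε ∈ Set.Icc (0 : ℝ) 1) (t : ℝ) (ht : 0 ≤ t) :
    iteratedDeriv k (fun u : ℝ => Real.exp (a * (u / (1 + ε * u)))) t =
      Real.exp (a * (t / (1 + ε * t))) *
        ∑ ℓ ∈ Finset.Icc 1 k,
          ((k.factorial : ℝ) / (ℓ.factorial : ℝ) *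
              (((Fintype.piFinset fun _ : Fin ℓ => Finset.Icc 1 k).filter
                  (fun α => ∑ i, α i = k)).card : ℝ)) *
            (a ^ ℓ * (-ε) ^ (k - ℓ) / (1 + ε * t) ^ (k + ℓ)) := by
  obtain ⟨n, rfl⟩ : ∃ n, k = n + 1 := ⟨k - 1, by omega⟩
  have hpos : 0 < 1 + ε * t := by
    have := mul_nonneg hε.1 ht
    linarith
  rw [iter_aux n a ε t hpos]
  congr 1
  refine Finset.sum_bij (fun m _ => m + 1) ?_ ?_ ?_ ?_
  · intro m hm
    simp only [Finset.mem_range, Finset.mem_Icc] at hm ⊢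
    omega
  · intro m _ m' _ h
    simpa using h
  · intro l hl
    simp only [Finset.mem_Icc] at hl
    exact ⟨l - 1, by simp only [Finset.mem_range]; omega, by omega⟩
  · intro m hm
    have hm' : m ≤ n := by simpa [Nat.lt_succ_iff] using hm
    rw [card_comp_aux n m hm', lahC, Nat.add_sub_add_right]
    congr 3
    omega
end

section
/- Ordered-product square-root inequality (established in the proof of Lemma A.2 of the paper): let m ∈ ℕ, let θ ≥ 0 be a real number, and let ω₀ ≥ ω₁ ≥ ⋯ ≥ ω_{m−1} ≥ 0 be real numbers listed in decreasing order. Then Π_{i=0}^{m−1} (θ + Σ_{j=i}^{m−1} ω_j)^{1/2} ≤ (m!)^{1/2} · Π_{i=0}^{m−1} (θ^{1/2} + ω_i^{1/2}). (For m = 0 both sides are the empty product 1.) -/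
open Finset

/-- Ordered-product square-root inequality from the proof of Lemma A.2:
for `θ ≥ 0` and `ω₀ ≥ ω₁ ≥ ⋯ ≥ ω_{m-1} ≥ 0`,
`∏_i (θ + ∑_{j≥i} ω_j)^{1/2} ≤ (m!)^{1/2} ∏_i (θ^{1/2} + ω_i^{1/2})`. -/
theorem orderedProd_sqrt_le (m : ℕ) (θ : ℝ) (hθ : 0 ≤ θ) (ω : Fin m → ℝ)
    (hω : ∀ i, 0 ≤ ω i) (hmono : ∀ i j : Fin m, i ≤ j → ω j ≤ ω i) :
    (∏ i, Real.sqrt (θ + ∑ j ∈ Finset.Ici i, ω j)) ≤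
      Real.sqrt (m.factorial : ℝ) * ∏ i, (Real.sqrt θ + Real.sqrt (ω i)) := by
  have hfac : ∏ i : Fin m, Real.sqrt ((m - (i : ℕ) : ℕ) : ℝ) = Real.sqrt (m.factorial : ℝ) := by
    have h1 : ∏ i : Fin m, (m - (i : ℕ)) = m.factorial := by
      rw [Fin.prod_univ_eq_prod_range (fun i => m - i) m, ← Finset.prod_range_add_one_eq_factorial,
        ← Finset.prod_range_reflect]
      apply Finset.prod_congr rfl
      intro i hi
      have := Finset.mem_range.mp hi
      omega
    rw [← h1, Nat.cast_prod, Real.sqrt_prod]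
    intro i _
    positivity
  rw [← hfac, ← Finset.prod_mul_distrib]
  apply Finset.prod_le_prod
  · intro i _
    exact Real.sqrt_nonneg _
  · intro i _
    have hsum : ∑ j ∈ Finset.Ici i, ω j ≤ ((m - (i : ℕ) : ℕ) : ℝ) * ω i := by
      have h := Finset.sum_le_card_nsmul (Finset.Ici i) ω (ω i)
        (fun j hj => hmono i j (Finset.mem_Ici.mp hj))
      rwa [Fin.card_Ici, nsmul_eq_mul] at h
    have hone : (1 : ℝ) ≤ ((m - (i : ℕ) : ℕ) : ℝ) := by
      have := i.isLt
      exact_mod_cast (by omega : 1 ≤ m - (i : ℕ))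
    have hle : θ + ∑ j ∈ Finset.Ici i, ω j ≤ ((m - (i : ℕ) : ℕ) : ℝ) * (θ + ω i) := by
      nlinarith
    calc Real.sqrt (θ + ∑ j ∈ Finset.Ici i, ω j)
        ≤ Real.sqrt (((m - (i : ℕ) : ℕ) : ℝ) * (θ + ω i)) := Real.sqrt_le_sqrt hle
      _ = Real.sqrt ((m - (i : ℕ) : ℕ) : ℝ) * Real.sqrt (θ + ω i) :=
          Real.sqrt_mul (by positivity) _
      _ ≤ _ := by
          apply mul_le_mul_of_nonneg_left _ (Real.sqrt_nonneg _)
          rw [Real.sqrt_le_left (by positivity)]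
          nlinarith [Real.sq_sqrt hθ, Real.sq_sqrt (hω i),
            mul_nonneg (Real.sqrt_nonneg θ) (Real.sqrt_nonneg (ω i))]
end

section
/- Coulomb singularity comparison inequality (proved in Example 2.8(2) of the paper): for all y, R ∈ ℝ³ with y ≠ 0 and y ≠ R, | 1/‖y − R‖ − 1/‖y‖ | ≤ ‖R‖^{1/2} · ( ‖y − R‖^{−3/2} + ‖y‖^{−3/2} ). -/
theorem coulomb_aux_sqrt (s t q : ℝ) (hs : 0 < s) (hst : s ≤ t) (hq : 0 ≤ q)
    (h : t ^ 2 - s ^ 2 ≤ q ^ 2) :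
    1 / s ^ 2 - 1 / t ^ 2 ≤ q * (s ^ 3)⁻¹ := by
  have ht : 0 < t := hs.trans_le hst
  have key : s * (t ^ 2 - s ^ 2) ≤ q * t ^ 2 := by
    rcases le_total s q with hsq | hsq
    · have h1 : s * t ^ 2 ≤ q * t ^ 2 := by gcongr
      nlinarith [pow_pos hs 3]
    · calc s * (t ^ 2 - s ^ 2) ≤ s * q ^ 2 := by gcongr
        _ = q * (s * q) := by ring
        _ ≤ q * (t * t) := by
          gcongr
          exact hsq.trans hst
        _ = q * t ^ 2 := by ring
  have e : q * (s ^ 3)⁻¹ - (1 / s ^ 2 - 1 / t ^ 2)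
      = (q * t ^ 2 - s * (t ^ 2 - s ^ 2)) / (s ^ 3 * t ^ 2) := by
    field_simp
  have : 0 ≤ (q * t ^ 2 - s * (t ^ 2 - s ^ 2)) / (s ^ 3 * t ^ 2) :=
    div_nonneg (by linarith) (by positivity)
  linarith

theorem coulomb_aux_rpow (a : ℝ) (ha : 0 ≤ a) :
    a ^ (-(3 : ℝ) / 2) = (Real.sqrt a ^ 3)⁻¹ := by
  rw [Real.sqrt_eq_rpow, ← Real.rpow_natCast, ← Real.rpow_mul ha, ← Real.rpow_neg ha]
  norm_num

/-- Coulomb singularity comparison inequality (from Example 2.8(2)):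
`|1/‖y-R‖ - 1/‖y‖| ≤ ‖R‖^{1/2} (‖y-R‖^{-3/2} + ‖y‖^{-3/2})` on `ℝ³`. -/
theorem coulomb_comparison (y R : EuclideanSpace ℝ (Fin 3)) (hy : y ≠ 0) (hyR : y ≠ R) :
    |1 / ‖y - R‖ - 1 / ‖y‖| ≤
      ‖R‖ ^ ((1 : ℝ) / 2) * (‖y - R‖ ^ (-(3 : ℝ) / 2) + ‖y‖ ^ (-(3 : ℝ) / 2)) := by
  have hb : 0 < ‖y‖ := norm_pos_iff.2 hy
  have ha : 0 < ‖y - R‖ := norm_pos_iff.2 (sub_ne_zero.2 hyR)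
  have h1 : ‖y‖ - ‖y - R‖ ≤ ‖R‖ := by
    have := norm_sub_norm_le y (y - R)
    simpa using this
  have h2 : ‖y - R‖ - ‖y‖ ≤ ‖R‖ := by
    have := norm_sub_le y R
    linarith
  have hr : 0 ≤ ‖R‖ := norm_nonneg R
  rw [coulomb_aux_rpow _ ha.le, coulomb_aux_rpow _ hb.le, ← Real.sqrt_eq_rpow]
  generalize ‖y - R‖ = a at *
  generalize ‖y‖ = b at *
  generalize ‖R‖ = r at *
  have hs := Real.sqrt_pos.2 ha
  have ht := Real.sqrt_pos.2 hb
  have hq := Real.sqrt_nonneg r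
  have es := Real.sq_sqrt ha.le
  have et := Real.sq_sqrt hb.le
  have eq := Real.sq_sqrt hr
  have p1 : 0 ≤ √r * (√a ^ 3)⁻¹ := by positivity
  have p2 : 0 ≤ √r * (√b ^ 3)⁻¹ := by positivity
  rw [mul_add]
  rcases le_total a b with hab | hab
  · have := coulomb_aux_sqrt (√a) (√b) (√r) hs (Real.sqrt_le_sqrt hab) hq (by linarith)
    rw [es, et] at this
    have h3 := one_div_le_one_div_of_le ha hab
    rw [abs_of_nonneg (by linarith)]
    linarith
  · have := coulomb_aux_sqrt (√b) (√a) (√r) ht (Real.sqrt_le_sqrt hab) hq (by linarith)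
    rw [es, et] at this
    have h3 := one_div_le_one_div_of_le hb hab
    rw [abs_of_nonpos (by linarith)]
    linarith
end

section
/- Algebraic commutator identity (Lemma 5.5 / eq. (i1i5) of the paper, stated on a common invariant core): let E be a complex inner product space, let Θ : E → E be a symmetric linear map, let ν ∈ ℕ and let v = (v₁,…,v_ν) and ṽ = (ṽ₁,…,ṽ_ν) be tuples of symmetric linear maps E → E, and let η, η̃ ∈ E. Then −Re Σ_j ⟪η − η̃, Θ²v_j²η − Θ²ṽ_j²η̃⟫ + Σ_j ‖Θv_jη − Θṽ_jη̃‖² = Σ_j ‖Θ(v_j − ṽ_j)η̃‖² + (1/2)·Re Σ_j ⟪η − η̃, [[v_j, Θ²], v_j](η − η̃)⟫ − 2 Re Σ_j ⟪(Θ[v_j, Θ] + [v_j, Θ]Θ)(η − η̃), (v_j − ṽ_j)η̃⟫ + Re Σ_j ⟪(v_j − ṽ_j)Θ(η − η̃), Θ(v_j − ṽ_j)η̃⟫ + Re Σ_j ⟪[v_j − ṽ_j, Θ]Θ(η − η̃), (v_j − ṽ_j)η̃⟫ − Re Σ_j ⟪Θ(η − η̃), Θ[v_j, ṽ_j]η̃⟫,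 where all sums run over j = 1,…,ν. -/
open scoped InnerProductSpace

/-- Commutator `[S, T] = S ∘ T - T ∘ S` of two linear endomorphisms. -/
def commOp {E : Type*} [AddCommGroup E] [Module ℂ E]
    (S T : E →ₗ[ℂ] E) : E →ₗ[ℂ] E :=
  S ∘ₗ T - T ∘ₗ S

/-- Algebraic commutator identity (Lemma 5.5 / eq. (i1i5)), stated for symmetric
linear endomorphisms of a complex inner product space. -/
theorem commutator_identity {E : Type*} [NormedAddCommGroup E] [InnerProductSpace ℂ E]
    {ν : ℕ} (Θ : E →ₗ[ℂ] E) (hΘ : Θ.IsSymmetric)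
    (v w : Fin ν → E →ₗ[ℂ] E)
    (hv : ∀ j, (v j).IsSymmetric) (hw : ∀ j, (w j).IsSymmetric)
    (η η' : E) :
    (-(∑ j, (⟪η - η', Θ (Θ (v j (v j η))) - Θ (Θ (w j (w j η')))⟫_ℂ).re)
        + ∑ j, ‖Θ (v j η) - Θ (w j η')‖ ^ 2) =
      (∑ j, ‖Θ ((v j - w j) η')‖ ^ 2)
        + (1 / 2) * (∑ j, (⟪η - η',
            (commOp (commOp (v j) (Θ ∘ₗ Θ)) (v j)) (η - η')⟫_ℂ).re)
        - 2 * (∑ j, (⟪(Θ ∘ₗ commOp (v j) Θ + commOp (v j) Θ ∘ₗ Θ) (η - η'),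
            (v j - w j) η'⟫_ℂ).re)
        + (∑ j, (⟪(v j - w j) (Θ (η - η')), Θ ((v j - w j) η')⟫_ℂ).re)
        + (∑ j, (⟪(commOp (v j - w j) Θ) (Θ (η - η')), (v j - w j) η'⟫_ℂ).re)
        - (∑ j, (⟪Θ (η - η'), Θ ((commOp (v j) (w j)) η')⟫_ℂ).re) := by
  obtain ⟨ξ, rfl⟩ : ∃ ξ, η = ξ + η' := ⟨η - η', by simp⟩
  simp only [add_sub_cancel_right, Finset.mul_sum, ← Finset.sum_neg_distrib,
    ← Finset.sum_add_distrib, ← Finset.sum_sub_distrib]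
  refine Finset.sum_congr rfl fun j _ => ?_
  have hn : ∀ x : E, ‖x‖ ^ 2 = (⟪x, x⟫_ℂ).re := fun x => by
    rw [inner_self_eq_norm_sq_to_K]; norm_cast
  have hT : ∀ x y, ⟪Θ x, y⟫_ℂ = ⟪x, Θ y⟫_ℂ := fun x y => hΘ x y
  have hV : ∀ x y, ⟪v j x, y⟫_ℂ = ⟪x, v j y⟫_ℂ := fun x y => hv j x y
  have hW : ∀ x y, ⟪w j x, y⟫_ℂ = ⟪x, w j y⟫_ℂ := fun x y => hw j x y
  have hs : ∀ x y : E, (⟪x, y⟫_ℂ).re = (⟪y, x⟫_ℂ).re := fun x y => by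
    rw [← inner_conj_symm, Complex.conj_re]
  have e1 := hs ξ (Θ (Θ (v j (v j ξ))))
  have e2 := hs η' (v j (Θ (Θ (v j ξ))))
  have e3 := hs η' (w j (Θ (Θ (v j ξ))))
  simp only [hT, hV, hW] at e1 e2 e3
  simp only [hn, commOp, LinearMap.sub_apply, LinearMap.add_apply, LinearMap.comp_apply,
    map_add, map_sub, inner_add_left, inner_add_right, inner_sub_left, inner_sub_right,
    hT, hV, hW, Complex.add_re, Complex.sub_re]
  linarith
end
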